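/- Let μ ≥ 0, let P⁻ = N(0,1) and P⁺ = N(μ,1) be Gaussian measures on ℝ, let N ≥ 1 be an integer and B > 0 a risk budget with B/N ∈ (0,1). Then the supremum, over all N-tuples of measurable sets A₁, …, A_N ⊆ ℝ satisfying ∑_{n=1}^N P⁻(A_n) ≤ B, of the total utility ∑_{n=1}^N P⁺(A_n), equals exactly U*(N,B) = N · Φ(Φ⁻¹(B/N) + μ): the per-step Neyman–Pearson bound together with concavity of δ ↦ Φ(Φ⁻¹(δ)+μ) shows no allocation exceeds this value, and the equal allocation δ_n = B/N with one-sided threshold tests achieves it. -/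

import Mathlib

open MeasureTheory ProbabilityTheory Set

/-- The standard normal CDF Φ(x) = ∫_{−∞}^{x} (2π)^{−1/2} e^{−t²/2} dt. -/
noncomputable def stdNormalCDF (x : ℝ) : ℝ :=
  ∫ t in Set.Iic x, (Real.sqrt (2 * Real.pi))⁻¹ * Real.exp (-(t ^ 2) / 2)

/-- The inverse Φ⁻¹ of the standard normal CDF (meaningful on (0,1)). -/
noncomputable def stdNormalCDFInv : ℝ → ℝ :=
  Function.invFun stdNormalCDF

lemma aux_toReal (m : ℝ) (S : Set ℝ) :
    (gaussianReal m 1 S).toReal = ∫ x in S, gaussianPDFReal m 1 x := by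
  rw [gaussianReal_apply_eq_integral m one_ne_zero, ENNReal.toReal_ofReal]
  exact integral_nonneg fun x => gaussianPDFReal_nonneg m 1 x

lemma aux_cdf (x : ℝ) : stdNormalCDF x = (gaussianReal 0 1 (Iic x)).toReal := by
  rw [aux_toReal]
  simp [stdNormalCDF, gaussianPDFReal]

lemma aux_cont : Continuous stdNormalCDF := by
  have hi := integrable_gaussianPDFReal 0 1
  have h : stdNormalCDF = fun x => stdNormalCDF 0 + ∫ t in (0:ℝ)..x, gaussianPDFReal 0 1 t := by
    funext x
    rw [aux_cdf, aux_cdf, aux_toReal, aux_toReal,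
      ← intervalIntegral.integral_Iic_sub_Iic hi.integrableOn hi.integrableOn]
    ring
  rw [h]
  exact continuous_const.add
    (intervalIntegral.continuous_primitive (fun a b => hi.intervalIntegrable) 0)

lemma aux_inv (p : ℝ) (hp : p ∈ Ioo (0:ℝ) 1) : stdNormalCDF (stdNormalCDFInv p) = p := by
  have hc : ∀ x, stdNormalCDF x = cdf (gaussianReal 0 1) x := by
    intro x
    rw [aux_cdf, cdf_eq_real]; rfl
  have h0 := (tendsto_cdf_atBot (gaussianReal 0 1)).eventually (gt_mem_nhds hp.1)
  have h1 := (tendsto_cdf_atTop (gaussianReal 0 1)).eventually (lt_mem_nhds hp.2)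
  obtain ⟨a, ha⟩ := h0.exists
  obtain ⟨b, hb⟩ := h1.exists
  have : p ∈ range stdNormalCDF := mem_range_of_exists_le_of_exists_ge aux_cont
    ⟨a, by rw [hc]; exact ha.le⟩ ⟨b, by rw [hc]; exact hb.le⟩
  exact Function.invFun_eq this

lemma aux_T (m z : ℝ) : (gaussianReal m 1 (Ici (-z))).toReal = stdNormalCDF (z + m) := by
  have h : (gaussianReal 0 1).map (fun x => m - x) = gaussianReal m 1 := by
    simpa using gaussianReal_map_const_sub (μ := 0) (v := 1) m
  rw [← h, Measure.map_apply (by fun_prop) measurableSet_Ici, aux_cdf]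
  congr 2
  ext x
  simp only [mem_preimage, mem_Ici, mem_Iic]
  constructor <;> intro h <;> linarith

lemma aux_pdf (μ x : ℝ) :
    gaussianPDFReal μ 1 x = Real.exp (μ * x - μ ^ 2 / 2) * gaussianPDFReal 0 1 x := by
  simp only [gaussianPDFReal]
  rw [mul_left_comm, ← Real.exp_add]
  congr 2
  simp
  ring

lemma aux_NP (μ : ℝ) (hμ : 0 ≤ μ) (z : ℝ) (A : Set ℝ) (hA : MeasurableSet A) :
    (gaussianReal μ 1 A).toReal
        - Real.exp (μ * (-z) - μ ^ 2 / 2) * (gaussianReal 0 1 A).toReal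
      ≤ stdNormalCDF (z + μ) - Real.exp (μ * (-z) - μ ^ 2 / 2) * stdNormalCDF z := by
  set k := Real.exp (μ * (-z) - μ ^ 2 / 2) with hk
  have hz : stdNormalCDF z = (gaussianReal 0 1 (Ici (-z))).toReal := by
    rw [aux_T, add_zero]
  have h1 := integrable_gaussianPDFReal μ 1
  have h0 := (integrable_gaussianPDFReal 0 1).const_mul k
  have key : ∀ S : Set ℝ, MeasurableSet S → (gaussianReal μ 1 S).toReal
      - k * (gaussianReal 0 1 S).toReal
      = ∫ x, S.indicator (fun x => gaussianPDFReal μ 1 x - k * gaussianPDFReal 0 1 x) x := by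
    intro S hS
    rw [integral_indicator hS, integral_sub h1.integrableOn h0.integrableOn,
      integral_const_mul, aux_toReal, aux_toReal]
  rw [← aux_T, hz, key A hA, key _ measurableSet_Ici]
  refine integral_mono ((h1.sub h0).indicator hA) ((h1.sub h0).indicator measurableSet_Ici) ?_
  intro x
  have hf := gaussianPDFReal_nonneg 0 1 x
  have e : gaussianPDFReal μ 1 x - k * gaussianPDFReal 0 1 x
      = (Real.exp (μ * x - μ ^ 2 / 2) - k) * gaussianPDFReal 0 1 x := by
    rw [aux_pdf μ x]; ring
  by_cases hx : x ∈ Ici (-z)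
  · have hx' : -z ≤ x := hx
    have : 0 ≤ gaussianPDFReal μ 1 x - k * gaussianPDFReal 0 1 x := by
      rw [e]
      refine mul_nonneg (sub_nonneg.2 (Real.exp_le_exp.2 ?_)) hf
      nlinarith
    rw [indicator_of_mem hx]
    by_cases ha : x ∈ A <;> simp only [ha, indicator_of_mem, indicator_of_notMem,
      not_false_eq_true, le_refl, this]
  · have hx' : x < -z := by simpa using hx
    have : gaussianPDFReal μ 1 x - k * gaussianPDFReal 0 1 x ≤ 0 := by
      rw [e]
      refine mul_nonpos_of_nonpos_of_nonneg (sub_nonpos.2 (Real.exp_le_exp.2 ?_)) hf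
      nlinarith
    rw [indicator_of_notMem hx]
    by_cases ha : x ∈ A <;> simp only [ha, indicator_of_mem, indicator_of_notMem,
      not_false_eq_true, le_refl, this]



/-- Exact finite-horizon ceiling: over all N-tuples of measurable acceptance
sets with total false-accept budget ∑ P⁻(A_n) ≤ B, the maximal total utility
∑ P⁺(A_n) equals U*(N,B) = N·Φ(Φ⁻¹(B/N) + μ), and it is attained. -/
theorem stmt_10 (μ : ℝ) (hμ : 0 ≤ μ) (N : ℕ) (hN : 1 ≤ N) (B : ℝ) (hB : 0 < B)
    (hBN : B / N ∈ Set.Ioo (0 : ℝ) 1) :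
    IsGreatest
      {u : ℝ | ∃ A : Fin N → Set ℝ, (∀ n, MeasurableSet (A n)) ∧
        (∑ n, (gaussianReal 0 1 (A n)).toReal) ≤ B ∧
        u = ∑ n, (gaussianReal μ 1 (A n)).toReal}
      ((N : ℝ) * stdNormalCDF (stdNormalCDFInv (B / N) + μ)) := by
  have hNpos : (0:ℝ) < N := by exact_mod_cast hN
  have hz := aux_inv _ hBN
  set z := stdNormalCDFInv (B / N) with hzdef
  have hNB : (N:ℝ) * (B / N) = B := by field_simp
  constructor
  · refine ⟨fun _ => Ici (-z), fun _ => measurableSet_Ici, ?_, ?_⟩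
    · simp only [aux_T, add_zero, hz, Finset.sum_const, Finset.card_univ, Fintype.card_fin,
        nsmul_eq_mul]
      exact hNB.le
    · simp only [aux_T, Finset.sum_const, Finset.card_univ, Fintype.card_fin, nsmul_eq_mul]
  · rintro u ⟨A, hA, hsum, rfl⟩
    have h := Finset.sum_le_sum (s := Finset.univ) fun n _ => aux_NP μ hμ z (A n) (hA n)
    simp only [Finset.sum_sub_distrib, ← Finset.mul_sum, Finset.sum_const, Finset.card_univ,
      Fintype.card_fin, nsmul_eq_mul, hz, hNB] at h
    have := mul_le_mul_of_nonneg_left hsum (Real.exp_pos (μ * (-z) - μ ^ 2 / 2)).le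
    linarith
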